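/- Let 𝒜 be a central hyperplane arrangement in ℝⁿ with base region B. A region J is join-irreducible in 𝒫(𝒜,B) if and only if J is a minimal element of U(Σ) for some shard Σ of (𝒜,B); in that case J covers exactly one region J_* in 𝒫(𝒜,B), and S(J_*) = S(J) − {H_Σ}. -/

import Mathlib

open scoped RealInnerProductSpace

noncomputable section

variable {n : ℕ}

/-- A (linear) hyperplane in ℝⁿ: the zero set of a nonzero linear functional,
expressed via the inner product with a nonzero normal vector. -/
def IsHyperplane (H : Set (EuclideanSpace ℝ (Fin n))) : Prop :=
  ∃ v : EuclideanSpace ℝ (Fin n), v ≠ 0 ∧ H = {x | ⟪v, x⟫ = 0}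

/-- A central hyperplane arrangement: a finite nonempty collection of linear hyperplanes. -/
def IsCentralArrangement (A : Set (Set (EuclideanSpace ℝ (Fin n)))) : Prop :=
  A.Finite ∧ A.Nonempty ∧ ∀ H ∈ A, IsHyperplane H

/-- The complement of the union of the hyperplanes of the arrangement. -/
def arrComplement (A : Set (Set (EuclideanSpace ℝ (Fin n)))) : Set (EuclideanSpace ℝ (Fin n)) :=
  (⋃ H ∈ A, H)ᶜ

/-- A region of the arrangement: the closure of a connected component of the complement
of the union of the hyperplanes. -/
def IsRegion (A : Set (Set (EuclideanSpace ℝ (Fin n)))) (R : Set (EuclideanSpace ℝ (Fin n))) :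
    Prop :=
  ∃ x ∈ arrComplement A, R = closure (connectedComponentIn (arrComplement A) x)

/-- The hyperplane `H` separates the region `R` from the region `B`: their interiors lie on
strictly opposite sides of `H`. -/
def Separates (H R B : Set (EuclideanSpace ℝ (Fin n))) : Prop :=
  ∃ v : EuclideanSpace ℝ (Fin n), v ≠ 0 ∧ H = {x | ⟪v, x⟫ = 0} ∧
    (∀ x ∈ interior R, 0 < ⟪v, x⟫) ∧ (∀ x ∈ interior B, ⟪v, x⟫ < 0)

/-- S(R): the set of hyperplanes of `A` separating `R` from the base region `B`. -/
def sepSet (A : Set (Set (EuclideanSpace ℝ (Fin n)))) (B R : Set (EuclideanSpace ℝ (Fin n))) :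
    Set (Set (EuclideanSpace ℝ (Fin n))) :=
  {H | H ∈ A ∧ Separates H R B}

/-- The order of the poset of regions 𝒫(𝒜,B): containment of separating sets. -/
def regLE (A : Set (Set (EuclideanSpace ℝ (Fin n)))) (B R₁ R₂ : Set (EuclideanSpace ℝ (Fin n))) :
    Prop :=
  sepSet A B R₁ ⊆ sepSet A B R₂

/-- Strict order on regions. -/
def regLT (A : Set (Set (EuclideanSpace ℝ (Fin n)))) (B R₁ R₂ : Set (EuclideanSpace ℝ (Fin n))) :
    Prop :=
  regLE A B R₁ R₂ ∧ ¬ regLE A B R₂ R₁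

/-- The order dimension of the poset of regions 𝒫(𝒜,B): the smallest `d` such that it embeds
as an induced subposet of ℝᵈ with the componentwise order. -/
def regionOrderDim (A : Set (Set (EuclideanSpace ℝ (Fin n))))
    (B : Set (EuclideanSpace ℝ (Fin n))) : ℕ :=
  sInf {d : ℕ | ∃ f : {R : Set (EuclideanSpace ℝ (Fin n)) // IsRegion A R} → (Fin d → ℝ),
    ∀ R₁ R₂, regLE A B R₁.1 R₂.1 ↔ ∀ i, f R₁ i ≤ f R₂ i}

/-- The rank-two subarrangement of `A` consisting of all hyperplanes of `A`
containing `H₁ ∩ H₂`. -/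
def pencil (A : Set (Set (EuclideanSpace ℝ (Fin n)))) (H₁ H₂ : Set (EuclideanSpace ℝ (Fin n))) :
    Set (Set (EuclideanSpace ℝ (Fin n))) :=
  {H | H ∈ A ∧ H₁ ∩ H₂ ⊆ H}

/-- `H` is basic in the subarrangement `A'` relative to the base region `B`:
`H ∈ A'` and `H` bounds (meets in codimension one) the region `B'` of `A'` containing `B`. -/
def IsBasicIn (A' : Set (Set (EuclideanSpace ℝ (Fin n)))) (B H : Set (EuclideanSpace ℝ (Fin n))) :
    Prop :=
  H ∈ A' ∧ ∃ B', IsRegion A' B' ∧ B ⊆ B' ∧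
    Submodule.span ℝ (H ∩ B') = Submodule.span ℝ H

/-- The edge relation of the basic digraph 𝒟(𝒜,B): `H₁ → H₂` whenever `H₁` is basic in the
rank-two subarrangement consisting of all hyperplanes of `A` containing `H₁ ∩ H₂`. -/
def BasicEdge (A : Set (Set (EuclideanSpace ℝ (Fin n))))
    (B H₁ H₂ : Set (EuclideanSpace ℝ (Fin n))) : Prop :=
  H₁ ∈ A ∧ H₂ ∈ A ∧ H₁ ≠ H₂ ∧ IsBasicIn (pencil A H₁ H₂) B H₁

/-- The hyperplane `H` with the cutting loci removed: for each rank-two subarrangement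
containing `H` in which `H` is not basic, the codimension-two intersection is removed. -/
def shardCut (A : Set (Set (EuclideanSpace ℝ (Fin n)))) (B H : Set (EuclideanSpace ℝ (Fin n))) :
    Set (EuclideanSpace ℝ (Fin n)) :=
  H \ ⋃ H' ∈ {H' | H' ∈ A ∧ H' ≠ H ∧ ¬ IsBasicIn (pencil A H H') B H}, (H ∩ H')

/-- `Sg` is a shard of `(A,B)` contained in the hyperplane `H`: a connected component of `H`
with the cutting loci removed. -/
def IsShardOf (A : Set (Set (EuclideanSpace ℝ (Fin n))))
    (B H Sg : Set (EuclideanSpace ℝ (Fin n))) : Prop :=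
  H ∈ A ∧ ∃ x ∈ shardCut A B H, Sg = connectedComponentIn (shardCut A B H) x

/-- U(Σ): the regions meeting the shard `Sg` in codimension one whose separating set
contains the hyperplane `H` containing `Sg`. -/
def upperRegions (A : Set (Set (EuclideanSpace ℝ (Fin n))))
    (B H Sg : Set (EuclideanSpace ℝ (Fin n))) : Set (Set (EuclideanSpace ℝ (Fin n))) :=
  {R | IsRegion A R ∧ Submodule.span ℝ (R ∩ Sg) = Submodule.span ℝ H ∧ H ∈ sepSet A B R}

/-- L(Σ): the regions meeting the shard `Sg` in codimension one whose separating set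
does not contain the hyperplane `H` containing `Sg`. -/
def lowerRegions (A : Set (Set (EuclideanSpace ℝ (Fin n))))
    (B H Sg : Set (EuclideanSpace ℝ (Fin n))) : Set (Set (EuclideanSpace ℝ (Fin n))) :=
  {R | IsRegion A R ∧ Submodule.span ℝ (R ∩ Sg) = Submodule.span ℝ H ∧ H ∉ sepSet A B R}

/-- `J` is a minimal element of U(Σ), as a subposet of 𝒫(𝒜,B). -/
def MinimalInU (A : Set (Set (EuclideanSpace ℝ (Fin n))))
    (B H Sg J : Set (EuclideanSpace ℝ (Fin n))) : Prop :=
  J ∈ upperRegions A B H Sg ∧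
    ∀ R ∈ upperRegions A B H Sg, regLE A B R J → regLE A B J R

/-- `M` is a maximal element of L(Σ), as a subposet of 𝒫(𝒜,B). -/
def MaximalInL (A : Set (Set (EuclideanSpace ℝ (Fin n))))
    (B H Sg M : Set (EuclideanSpace ℝ (Fin n))) : Prop :=
  M ∈ lowerRegions A B H Sg ∧
    ∀ R ∈ lowerRegions A B H Sg, regLE A B M R → regLE A B R M

/-- `J` covers `Jst` in the poset of regions 𝒫(𝒜,B). -/
def CoversReg (A : Set (Set (EuclideanSpace ℝ (Fin n))))
    (B J Jst : Set (EuclideanSpace ℝ (Fin n))) : Prop :=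
  IsRegion A Jst ∧ regLT A B Jst J ∧
    ∀ R, IsRegion A R → regLT A B Jst R → regLT A B R J → False

/-- `R` is an upper bound of the set `X` of regions in 𝒫(𝒜,B). -/
def regIsUB (A : Set (Set (EuclideanSpace ℝ (Fin n)))) (B : Set (EuclideanSpace ℝ (Fin n)))
    (X : Set (Set (EuclideanSpace ℝ (Fin n)))) (R : Set (EuclideanSpace ℝ (Fin n))) : Prop :=
  ∀ R' ∈ X, regLE A B R' R

/-- `R` is the least upper bound of the set `X` of regions in 𝒫(𝒜,B). -/
def regIsLUB (A : Set (Set (EuclideanSpace ℝ (Fin n)))) (B : Set (EuclideanSpace ℝ (Fin n)))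
    (X : Set (Set (EuclideanSpace ℝ (Fin n)))) (R : Set (EuclideanSpace ℝ (Fin n))) : Prop :=
  regIsUB A B X R ∧ ∀ R', IsRegion A R' → regIsUB A B X R' → regLE A B R R'

/-- `R` is a lower bound of the set `X` of regions in 𝒫(𝒜,B). -/
def regIsLB (A : Set (Set (EuclideanSpace ℝ (Fin n)))) (B : Set (EuclideanSpace ℝ (Fin n)))
    (X : Set (Set (EuclideanSpace ℝ (Fin n)))) (R : Set (EuclideanSpace ℝ (Fin n))) : Prop :=
  ∀ R' ∈ X, regLE A B R R'

/-- `R` is the greatest lower bound of the set `X` of regions in 𝒫(𝒜,B). -/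
def regIsGLB (A : Set (Set (EuclideanSpace ℝ (Fin n)))) (B : Set (EuclideanSpace ℝ (Fin n)))
    (X : Set (Set (EuclideanSpace ℝ (Fin n)))) (R : Set (EuclideanSpace ℝ (Fin n))) : Prop :=
  regIsLB A B X R ∧ ∀ R', IsRegion A R' → regIsLB A B X R' → regLE A B R' R

/-- `J` is join-irreducible in 𝒫(𝒜,B): there is no set `X` of regions with `J ∉ X`
whose least upper bound is `J`. -/
def JoinIrredReg (A : Set (Set (EuclideanSpace ℝ (Fin n))))
    (B J : Set (EuclideanSpace ℝ (Fin n))) : Prop :=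
  IsRegion A J ∧ ¬ ∃ X : Set (Set (EuclideanSpace ℝ (Fin n))),
    (∀ R ∈ X, IsRegion A R) ∧ J ∉ X ∧ regIsLUB A B X J

/-- `M` is meet-irreducible in 𝒫(𝒜,B): there is no set `X` of regions with `M ∉ X`
whose greatest lower bound is `M`. -/
def MeetIrredReg (A : Set (Set (EuclideanSpace ℝ (Fin n))))
    (B M : Set (EuclideanSpace ℝ (Fin n))) : Prop :=
  IsRegion A M ∧ ¬ ∃ X : Set (Set (EuclideanSpace ℝ (Fin n))),
    (∀ R ∈ X, IsRegion A R) ∧ M ∉ X ∧ regIsGLB A B X M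

/-- `(J,M)` is a subcritical pair in the poset of regions 𝒫(𝒜,B). -/
def SubcritReg (A : Set (Set (EuclideanSpace ℝ (Fin n))))
    (B J M : Set (EuclideanSpace ℝ (Fin n))) : Prop :=
  IsRegion A J ∧ IsRegion A M ∧ ¬ regLE A B J M ∧
    (∀ X, IsRegion A X → regLT A B X J → regLE A B X M) ∧
    (∀ X, IsRegion A X → regLT A B M X → regLE A B J X)

/-- A family of normal vectors `a` for the hyperplanes of `A`. -/
def IsNormalFamily (A : Set (Set (EuclideanSpace ℝ (Fin n))))
    (a : Set (EuclideanSpace ℝ (Fin n)) → EuclideanSpace ℝ (Fin n)) : Prop :=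
  ∀ K ∈ A, K = {x | ⟪a K, x⟫ = 0}

/-- The region of `A` containing the point `x`. -/
def regionOf (A : Set (Set (EuclideanSpace ℝ (Fin n)))) (x : EuclideanSpace ℝ (Fin n)) :
    Set (EuclideanSpace ℝ (Fin n)) :=
  closure (connectedComponentIn (arrComplement A) x)

section Regions

variable {A : Set (Set (EuclideanSpace ℝ (Fin n)))}
  {a : Set (EuclideanSpace ℝ (Fin n)) → EuclideanSpace ℝ (Fin n)}

theorem IsNormalFamily.mem_iff (ha : IsNormalFamily A a) {K : Set (EuclideanSpace ℝ (Fin n))}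
    (hK : K ∈ A) (x : EuclideanSpace ℝ (Fin n)) : x ∈ K ↔ ⟪a K, x⟫ = 0 := by
  conv_lhs => rw [ha K hK]
  rfl

theorem IsNormalFamily.mem_arrComplement (ha : IsNormalFamily A a)
    {x : EuclideanSpace ℝ (Fin n)} : x ∈ arrComplement A ↔ ∀ K ∈ A, ⟪a K, x⟫ ≠ 0 := by
  simp only [arrComplement, Set.mem_compl_iff, Set.mem_iUnion, not_exists]
  exact forall₂_congr fun K hK => not_congr (ha.mem_iff hK x)

theorem isRegion_regionOf {x : EuclideanSpace ℝ (Fin n)} (hx : x ∈ arrComplement A) :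
    IsRegion A (regionOf A x) := ⟨x, hx, rfl⟩

theorem IsNormalFamily.connectedComponentIn_eq (ha : IsNormalFamily A a)
    {x : EuclideanSpace ℝ (Fin n)} (hx : x ∈ arrComplement A) :
    connectedComponentIn (arrComplement A) x = {y | ∀ K ∈ A, 0 < ⟪a K, x⟫ * ⟪a K, y⟫} := by
  have hx' := ha.mem_arrComplement.1 hx
  apply Set.Subset.antisymm
  · intro y hy K hK
    have hpre : IsPreconnected ((fun z => ⟪a K, x⟫ * ⟪a K, z⟫) ''
        connectedComponentIn (arrComplement A) x) :=
      isPreconnected_connectedComponentIn.image _ (by fun_prop)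
    have hxm : ⟪a K, x⟫ * ⟪a K, x⟫ ∈ ((fun z => ⟪a K, x⟫ * ⟪a K, z⟫) ''
        connectedComponentIn (arrComplement A) x) :=
      ⟨x, mem_connectedComponentIn hx, rfl⟩
    by_contra hneg
    obtain ⟨z, hz, hz0⟩ := hpre.ordConnected.out ⟨y, hy, rfl⟩ hxm
      ⟨not_lt.1 hneg, mul_self_nonneg _⟩
    rcases mul_eq_zero.1 hz0 with h | h
    · exact hx' K hK h
    · exact ha.mem_arrComplement.1 (connectedComponentIn_subset _ _ hz) K hK h
  · have hconv : Convex ℝ {y | ∀ K ∈ A, 0 < ⟪a K, x⟫ * ⟪a K, y⟫} := by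
      intro y hy z hz s t hs ht hst K hK
      have h1 := hy K hK
      have h2 := hz K hK
      simp only [inner_add_right, real_inner_smul_right]
      rcases hs.eq_or_lt with rfl | hs
      · have : t = 1 := by linarith
        subst this; linarith
      · nlinarith [mul_pos hs h1, mul_nonneg ht h2.le]
    refine hconv.isPreconnected.subset_connectedComponentIn ?_ ?_
    · exact fun K hK => mul_self_pos.2 (hx' K hK)
    · exact fun y hy => ha.mem_arrComplement.2 fun K hK h => by
        have := hy K hK
        simp [h] at this

theorem IsNormalFamily.mem_regionOf (ha : IsNormalFamily A a)
    {x y : EuclideanSpace ℝ (Fin n)} (hx : x ∈ arrComplement A) :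
    y ∈ regionOf A x ↔ ∀ K ∈ A, 0 ≤ ⟪a K, x⟫ * ⟪a K, y⟫ := by
  have hx' := ha.mem_arrComplement.1 hx
  rw [regionOf, ha.connectedComponentIn_eq hx]
  constructor
  · intro hy K hK
    have hcl : IsClosed {z | 0 ≤ ⟪a K, x⟫ * ⟪a K, z⟫} :=
      isClosed_le (by fun_prop) (by fun_prop)
    exact closure_minimal (fun z hz => (hz K hK).le) hcl hy
  · intro hy
    have htend : Filter.Tendsto (fun t : ℝ => y + t • x) (nhdsWithin 0 (Set.Ioi 0)) (nhds y) := by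
      have : Continuous fun t : ℝ => y + t • x := by fun_prop
      simpa using (this.tendsto 0).mono_left nhdsWithin_le_nhds
    refine mem_closure_of_tendsto htend ?_
    filter_upwards [self_mem_nhdsWithin] with t (ht : 0 < t) K hK
    simp only [inner_add_right, real_inner_smul_right]
    nlinarith [hy K hK, mul_pos ht (mul_self_pos.2 (hx' K hK))]

theorem IsNormalFamily.pos_of_mem_interior_regionOf (ha : IsNormalFamily A a)
    {x y : EuclideanSpace ℝ (Fin n)} (hx : x ∈ arrComplement A)
    (hy : y ∈ interior (regionOf A x)) {K : Set (EuclideanSpace ℝ (Fin n))} (hK : K ∈ A) :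
    0 < ⟪a K, x⟫ * ⟪a K, y⟫ := by
  have htend : Filter.Tendsto (fun t : ℝ => y - t • x) (nhdsWithin 0 (Set.Ioi 0)) (nhds y) := by
    have : Continuous fun t : ℝ => y - t • x := by fun_prop
    simpa using (this.tendsto 0).mono_left nhdsWithin_le_nhds
  obtain ⟨t, ht, ht0 : 0 < t⟩ := ((htend.eventually (isOpen_interior.mem_nhds hy)).and
    self_mem_nhdsWithin).exists
  have h := (ha.mem_regionOf hx).1 (interior_subset ht) K hK
  simp only [inner_sub_right, real_inner_smul_right] at h
  nlinarith [mul_pos ht0 (mul_self_pos.2 (ha.mem_arrComplement.1 hx K hK))]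

theorem IsNormalFamily.mem_interior_regionOf (hfin : A.Finite) (ha : IsNormalFamily A a)
    {x : EuclideanSpace ℝ (Fin n)} (hx : x ∈ arrComplement A) :
    x ∈ interior (regionOf A x) := by
  refine interior_mono subset_closure ?_
  rw [ha.connectedComponentIn_eq hx]
  refine interior_maximal subset_rfl ?_ fun K hK =>
    mul_self_pos.2 (ha.mem_arrComplement.1 hx K hK)
  have : {y | ∀ K ∈ A, 0 < ⟪a K, x⟫ * ⟪a K, y⟫} =
      ⋂ K ∈ A, {y | 0 < ⟪a K, x⟫ * ⟪a K, y⟫} := by ext; simp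
  rw [this]
  exact hfin.isOpen_biInter fun K _ => isOpen_lt (by fun_prop) (by fun_prop)

/-- A hyperplane separates two regions iff its normal takes opposite signs on points of their
interiors. -/
theorem IsNormalFamily.mem_sepSet (hfin : A.Finite) (ha : IsNormalFamily A a)
    {b r : EuclideanSpace ℝ (Fin n)} (hb : b ∈ arrComplement A) (hr : r ∈ arrComplement A)
    {K : Set (EuclideanSpace ℝ (Fin n))} :
    K ∈ sepSet A (regionOf A b) (regionOf A r) ↔ K ∈ A ∧ ⟪a K, r⟫ * ⟪a K, b⟫ < 0 := by
  refine and_congr_right fun hK => ?_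
  have hb0 := ha.mem_arrComplement.1 hb K hK
  have hr0 := ha.mem_arrComplement.1 hr K hK
  constructor
  · rintro ⟨v, -, hKv, hvr, hvb⟩
    have hvr := hvr r (ha.mem_interior_regionOf hfin hr)
    have hvb := hvb b (ha.mem_interior_regionOf hfin hb)
    have hz : (-⟪v, b⟫) • r + ⟪v, r⟫ • b ∈ K := by
      rw [hKv]
      simp only [Set.mem_ofPred_eq, inner_add_right, real_inner_smul_right]
      ring
    rw [ha.mem_iff hK] at hz
    simp only [inner_add_right, real_inner_smul_right] at hz
    have hmul : ⟪v, b⟫ * ⟪a K, r⟫ ^ 2 = ⟪v, r⟫ * (⟪a K, r⟫ * ⟪a K, b⟫) := by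
      linear_combination (-⟪a K, r⟫) * hz
    have hsq : 0 < ⟪a K, r⟫ ^ 2 := by positivity
    by_contra hcon
    nlinarith [mul_nonneg hvr.le (not_lt.1 hcon), mul_pos (neg_pos.2 hvb) hsq]
  · intro hneg
    refine ⟨⟪a K, r⟫ • a K, ?_, ?_, fun x hx => ?_, fun x hx => ?_⟩
    · refine smul_ne_zero hr0 fun h => hr0 ?_
      rw [h, inner_zero_left]
    · ext x
      rw [ha.mem_iff hK]
      simp [real_inner_smul_left, hr0]
    · rw [real_inner_smul_left]
      exact ha.pos_of_mem_interior_regionOf hr hx hK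
    · rw [real_inner_smul_left]
      have h := ha.pos_of_mem_interior_regionOf hb hx hK
      have hsq : 0 < ⟪a K, b⟫ ^ 2 := by positivity
      by_contra hcon
      nlinarith [mul_pos_of_neg_of_neg hneg (neg_neg_of_pos h), mul_nonneg hsq.le (not_lt.1 hcon)]

theorem IsNormalFamily.regionOf_eq_of_sepSet_eq (hfin : A.Finite) (ha : IsNormalFamily A a)
    {b r s : EuclideanSpace ℝ (Fin n)} (hb : b ∈ arrComplement A) (hr : r ∈ arrComplement A)
    (hs : s ∈ arrComplement A)
    (h : sepSet A (regionOf A b) (regionOf A r) = sepSet A (regionOf A b) (regionOf A s)) :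
    regionOf A r = regionOf A s := by
  refine congrArg closure (_root_.connectedComponentIn_eq ?_)
  rw [ha.connectedComponentIn_eq hr]
  intro K hK
  have hb0 := ha.mem_arrComplement.1 hb K hK
  have hr0 := ha.mem_arrComplement.1 hr K hK
  have hs0 := ha.mem_arrComplement.1 hs K hK
  have hiff : ⟪a K, r⟫ * ⟪a K, b⟫ < 0 ↔ ⟪a K, s⟫ * ⟪a K, b⟫ < 0 := by
    have := Set.ext_iff.1 h K
    rw [ha.mem_sepSet hfin hb hr, ha.mem_sepSet hfin hb hs] at this
    simpa [hK] using this
  rcases hb0.lt_or_gt with hb0 | hb0 <;> rcases hr0.lt_or_gt with hr0 | hr0 <;>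
    rcases hs0.lt_or_gt with hs0 | hs0 <;>
    simp only [mul_neg_iff, mul_pos_iff, hb0, hr0, hs0, hb0.not_gt, hr0.not_gt, hs0.not_gt,
      and_true, and_false, or_true, or_false, true_iff, iff_true] at hiff ⊢

/-- A sufficiently small perturbation of a point does not change the nonzero signs. -/
theorem exists_perturbation (hfin : A.Finite)
    (a : Set (EuclideanSpace ℝ (Fin n)) → EuclideanSpace ℝ (Fin n))
    (z w : EuclideanSpace ℝ (Fin n)) :
    ∃ ε : ℝ, 0 < ε ∧ ∀ K ∈ A, (0 < ⟪a K, z⟫ → 0 < ⟪a K, z⟫ + ε * ⟪a K, w⟫) ∧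
      (⟪a K, z⟫ < 0 → ⟪a K, z⟫ + ε * ⟪a K, w⟫ < 0) := by
  have key : ∀ᶠ ε in nhdsWithin (0 : ℝ) (Set.Ioi 0), ∀ K ∈ A,
      (0 < ⟪a K, z⟫ → 0 < ⟪a K, z⟫ + ε * ⟪a K, w⟫) ∧
      (⟪a K, z⟫ < 0 → ⟪a K, z⟫ + ε * ⟪a K, w⟫ < 0) := by
    rw [Filter.eventually_all_finite hfin]
    intro K _
    have htend : Filter.Tendsto (fun ε : ℝ => ⟪a K, z⟫ + ε * ⟪a K, w⟫)
        (nhdsWithin 0 (Set.Ioi 0)) (nhds ⟪a K, z⟫) := by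
      have : Continuous fun ε : ℝ => ⟪a K, z⟫ + ε * ⟪a K, w⟫ := by fun_prop
      simpa using (this.tendsto 0).mono_left nhdsWithin_le_nhds
    rcases lt_trichotomy ⟪a K, z⟫ 0 with h | h | h
    · filter_upwards [htend.eventually_lt_const h] with ε hε
      exact ⟨fun h' => absurd h h'.not_gt, fun _ => hε⟩
    · exact Filter.Eventually.of_forall fun ε => ⟨fun h' => absurd h h'.ne', fun h' => absurd h h'.ne⟩
    · filter_upwards [htend.eventually_const_lt h] with ε hε
      exact ⟨fun _ => hε, fun h' => absurd h h'.not_gt⟩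
  obtain ⟨ε, h, hε⟩ := (key.and self_mem_nhdsWithin).exists
  exact ⟨ε, hε, h⟩

/-- A subset of a hyperplane that contains a relative neighbourhood of some point spans it. -/
theorem span_eq_of_ball_inter_subset {v g : EuclideanSpace ℝ (Fin n)} (hg : ⟪v, g⟫ = 0)
    {S : Set (EuclideanSpace ℝ (Fin n))} (hS : S ⊆ {x | ⟪v, x⟫ = 0}) {δ : ℝ} (hδ : 0 < δ)
    (h : Metric.ball g δ ∩ {x | ⟪v, x⟫ = 0} ⊆ S) :
    Submodule.span ℝ S = Submodule.span ℝ {x | ⟪v, x⟫ = 0} := by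
  refine le_antisymm (Submodule.span_mono hS) (Submodule.span_le.2 fun x hx => ?_)
  have hx : ⟪v, x⟫ = 0 := hx
  have htend : Filter.Tendsto (fun t : ℝ => g + t • x) (nhdsWithin 0 (Set.Ioi 0)) (nhds g) := by
    have : Continuous fun t : ℝ => g + t • x := by fun_prop
    simpa using (this.tendsto 0).mono_left nhdsWithin_le_nhds
  obtain ⟨t, ht, ht0 : 0 < t⟩ := ((htend.eventually (Metric.ball_mem_nhds g hδ)).and
    self_mem_nhdsWithin).exists
  have h1 : g ∈ Submodule.span ℝ S := Submodule.subset_span (h ⟨Metric.mem_ball_self hδ, hg⟩)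
  have h2 : g + t • x ∈ Submodule.span ℝ S := Submodule.subset_span (h ⟨ht, by
    simp [inner_add_right, real_inner_smul_right, hg, hx]⟩)
  have h3 : t • x ∈ Submodule.span ℝ S := by simpa using Submodule.sub_mem _ h2 h1
  exact (Submodule.smul_mem_iff _ ht0.ne').1 h3

theorem exists_ball_same_sign (hfin : A.Finite)
    (a : Set (EuclideanSpace ℝ (Fin n)) → EuclideanSpace ℝ (Fin n))
    {H : Set (EuclideanSpace ℝ (Fin n))} {g : EuclideanSpace ℝ (Fin n)}
    (hg : ∀ K ∈ A, K ≠ H → ⟪a K, g⟫ ≠ 0) :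
    ∃ δ : ℝ, 0 < δ ∧ ∀ y ∈ Metric.ball g δ, ∀ K ∈ A, K ≠ H → 0 < ⟪a K, g⟫ * ⟪a K, y⟫ := by
  have key : ∀ᶠ y in nhds g, ∀ K ∈ A, K ≠ H → 0 < ⟪a K, g⟫ * ⟪a K, y⟫ := by
    rw [Filter.eventually_all_finite hfin]
    intro K hK
    by_cases hKH : K = H
    · simp [hKH]
    have hcont : Continuous fun y => ⟪a K, g⟫ * ⟪a K, y⟫ := by fun_prop
    filter_upwards [(hcont.tendsto g).eventually_const_lt (mul_self_pos.2 (hg K hK hKH))]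
      with y hy _ using hy
  exact Metric.eventually_nhds_iff_ball.1 key

theorem IsNormalFamily.mem_shardCut (ha : IsNormalFamily A a)
    {B H : Set (EuclideanSpace ℝ (Fin n))} (hH : H ∈ A) {y : EuclideanSpace ℝ (Fin n)}
    (hy : ⟪a H, y⟫ = 0)
    (h : ∀ K ∈ A, K ≠ H → ⟪a K, y⟫ = 0 → IsBasicIn (pencil A H K) B H) :
    y ∈ shardCut A B H := by
  refine ⟨(ha.mem_iff hH y).2 hy, fun hmem => ?_⟩
  simp only [Set.mem_iUnion] at hmem
  obtain ⟨K, ⟨hK, hKH, hnb⟩, -, hyK⟩ := hmem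
  exact hnb (h K hK hKH ((ha.mem_iff hK y).1 hyK))

/-- A region adjacent to `H` at the point `g` meets the shard through `g` in codimension one. -/
theorem IsNormalFamily.span_regionOf_inter_shard (hfin : A.Finite) (ha : IsNormalFamily A a)
    {B H : Set (EuclideanSpace ℝ (Fin n))} (hH : H ∈ A) {g r : EuclideanSpace ℝ (Fin n)}
    (hg : ⟪a H, g⟫ = 0) (hr : r ∈ arrComplement A)
    (hgr : ∀ K ∈ A, K ≠ H → 0 < ⟪a K, r⟫ * ⟪a K, g⟫) :
    Submodule.span ℝ (regionOf A r ∩ connectedComponentIn (shardCut A B H) g) =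
      Submodule.span ℝ H := by
  have hg0 : ∀ K ∈ A, K ≠ H → ⟪a K, g⟫ ≠ 0 := fun K hK hKH h => by
    simpa [h] using hgr K hK hKH
  obtain ⟨δ, hδ, hball⟩ := exists_ball_same_sign hfin a hg0
  have hHeq := ha H hH
  have hsub : regionOf A r ∩ connectedComponentIn (shardCut A B H) g ⊆ {x | ⟪a H, x⟫ = 0} :=
    fun x hx => (ha.mem_iff hH x).1 (connectedComponentIn_subset _ _ hx.2).1
  have hmem : Metric.ball g δ ∩ {x | ⟪a H, x⟫ = 0} ⊆
      regionOf A r ∩ connectedComponentIn (shardCut A B H) g := by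
    refine Set.subset_inter ?_ ?_
    · rintro y ⟨hy, hyH⟩
      rw [ha.mem_regionOf hr]
      intro K hK
      by_cases hKH : K = H
      · subst hKH
        rw [show ⟪a K, y⟫ = 0 from hyH, mul_zero]
      · have h1 := hgr K hK hKH
        have h2 := hball y hy K hK hKH
        by_contra hcon
        have hsq : 0 < ⟪a K, g⟫ ^ 2 := by have := hg0 K hK hKH; positivity
        nlinarith [mul_pos h1 h2, mul_pos (neg_pos.2 (not_le.1 hcon)) hsq]
    · refine IsPreconnected.subset_connectedComponentIn ?_ ⟨Metric.mem_ball_self hδ, hg⟩ ?_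
      · refine ((convex_ball g δ).inter ?_).isPreconnected
        intro x hx y hy s t _ _ _
        simp only [Set.mem_ofPred_eq] at hx hy ⊢
        simp [inner_add_right, real_inner_smul_right, hx, hy]
      · rintro y ⟨hy, hyH⟩
        refine ha.mem_shardCut hH hyH fun K hK hKH h => ?_
        simpa [h] using hball y hy K hK hKH
  rw [span_eq_of_ball_inter_subset hg hsub hδ hmem, ← hHeq]

theorem IsNormalFamily.eq_of_subset (ha : IsNormalFamily A a)
    {H K : Set (EuclideanSpace ℝ (Fin n))} (hH : H ∈ A) (hK : K ∈ A)
    {j : EuclideanSpace ℝ (Fin n)} (hj : j ∈ arrComplement A) (h : H ⊆ K) : K = H := by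
  refine Set.Subset.antisymm (fun x hx => ?_) h
  have hjH := ha.mem_arrComplement.1 hj H hH
  have hjK := ha.mem_arrComplement.1 hj K hK
  have hz : ⟪a H, j⟫ • x - ⟪a H, x⟫ • j ∈ K := h <| by
    rw [ha.mem_iff hH]
    simp only [inner_sub_right, real_inner_smul_right]
    ring
  rw [ha.mem_iff hK] at hx hz
  simp only [inner_sub_right, real_inner_smul_right, hx, mul_zero, zero_sub, neg_eq_zero,
    mul_eq_zero, hjK, or_false] at hz
  exact (ha.mem_iff hH x).2 hz

end Regions

section Oriented

variable {A : Set (Set (EuclideanSpace ℝ (Fin n)))}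
  {a : Set (EuclideanSpace ℝ (Fin n)) → EuclideanSpace ℝ (Fin n)}
  {b j : EuclideanSpace ℝ (Fin n)} {H : Set (EuclideanSpace ℝ (Fin n))}

theorem IsCentralArrangement.exists_normalFamily (hA : IsCentralArrangement A)
    (hj : j ∈ arrComplement A) :
    ∃ a, IsNormalFamily A a ∧ ∀ K ∈ A, 0 < ⟪a K, j⟫ := by
  choose! v hv0 hv using hA.2.2
  have hvn : IsNormalFamily A v := hv
  have hj0 := hvn.mem_arrComplement.1 hj
  refine ⟨fun K => ⟪v K, j⟫ • v K, fun K hK => ?_, fun K hK => ?_⟩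
  · ext x
    rw [hvn.mem_iff hK]
    simp [real_inner_smul_left, hj0 K hK]
  · rw [real_inner_smul_left]
    exact mul_self_pos.2 (hj0 K hK)

theorem mem_arrComplement_of_pos (ha : IsNormalFamily A a) (hj : ∀ K ∈ A, 0 < ⟪a K, j⟫) :
    j ∈ arrComplement A := ha.mem_arrComplement.2 fun K hK => (hj K hK).ne'

theorem mem_sepSet_of_pos (hfin : A.Finite) (ha : IsNormalFamily A a)
    (hb : b ∈ arrComplement A) (hj : ∀ K ∈ A, 0 < ⟪a K, j⟫)
    {K : Set (EuclideanSpace ℝ (Fin n))} :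
    K ∈ sepSet A (regionOf A b) (regionOf A j) ↔ K ∈ A ∧ ⟪a K, b⟫ < 0 := by
  rw [ha.mem_sepSet hfin hb (mem_arrComplement_of_pos ha hj)]
  refine and_congr_right fun hK => ?_
  have := hj K hK
  exact ⟨fun h => by by_contra h'; nlinarith, fun h => by nlinarith⟩

/-- A region lies below the region of `j` as soon as every hyperplane separating the two
also separates `j` from the base region. -/
theorem regLE_of_pos (hfin : A.Finite) (ha : IsNormalFamily A a)
    (hb : b ∈ arrComplement A) (hj : ∀ K ∈ A, 0 < ⟪a K, j⟫) {r : EuclideanSpace ℝ (Fin n)}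
    (hr : r ∈ arrComplement A) (h : ∀ K ∈ A, ⟪a K, r⟫ < 0 → ⟪a K, b⟫ < 0) :
    regLE A (regionOf A b) (regionOf A r) (regionOf A j) := by
  intro K hK
  obtain ⟨hKA, hneg⟩ := (ha.mem_sepSet hfin hb hr).1 hK
  refine (mem_sepSet_of_pos hfin ha hb hj).2 ⟨hKA, ?_⟩
  by_contra hcon
  exact hcon (h K hKA (by by_contra h'; nlinarith [mul_nonneg (not_lt.1 h') (not_lt.1 hcon)]))

theorem not_regLE_of_pos (hfin : A.Finite) (ha : IsNormalFamily A a)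
    (hb : b ∈ arrComplement A) (hj : ∀ K ∈ A, 0 < ⟪a K, j⟫) {r : EuclideanSpace ℝ (Fin n)}
    (hr : r ∈ arrComplement A) {K : Set (EuclideanSpace ℝ (Fin n))} (hK : K ∈ A)
    (hKb : ⟪a K, b⟫ < 0) (hKr : ⟪a K, r⟫ < 0) :
    ¬ regLE A (regionOf A b) (regionOf A j) (regionOf A r) := fun h =>
  absurd ((ha.mem_sepSet hfin hb hr).1 (h ((mem_sepSet_of_pos hfin ha hb hj).2 ⟨hK, hKb⟩))).2
    (mul_pos_of_neg_of_neg hKr hKb).not_gt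

/-- If every hyperplane of the pencil of `H` and `L` separates `j` from the base region, and `H`
is a wall of the region of `j`, then `H` is basic in the pencil. -/
theorem isBasicIn_pencil (hfin : A.Finite) (ha : IsNormalFamily A a)
    (hb : b ∈ arrComplement A) (hH : H ∈ A) {f : EuclideanSpace ℝ (Fin n)}
    (hfH : ⟪a H, f⟫ = 0) (hf : ∀ K ∈ A, K ≠ H → 0 < ⟪a K, f⟫)
    {L : Set (EuclideanSpace ℝ (Fin n))} (hL : ∀ K ∈ pencil A H L, ⟪a K, b⟫ < 0) :
    IsBasicIn (pencil A H L) (regionOf A b) H := by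
  have hsub : pencil A H L ⊆ A := fun K hK => hK.1
  have hcompl : arrComplement A ⊆ arrComplement (pencil A H L) :=
    Set.compl_subset_compl.2 (Set.biUnion_subset_biUnion_left hsub)
  have hap : IsNormalFamily (pencil A H L) a := fun K hK => ha K (hsub hK)
  refine ⟨⟨hH, Set.inter_subset_left⟩, regionOf (pencil A H L) b, isRegion_regionOf (hcompl hb),
    closure_mono (connectedComponentIn_mono _ hcompl), ?_⟩
  have hfH' : ⟪a H, -f⟫ = 0 := by simp [hfH]
  obtain ⟨δ, hδ, hball⟩ := exists_ball_same_sign (g := -f) hfin a (H := H) fun K hK hKH => by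
    simpa using (hf K hK hKH).ne'
  have h1 : H ∩ regionOf (pencil A H L) b ⊆ {x | ⟪a H, x⟫ = 0} :=
    fun x hx => (ha.mem_iff hH x).1 hx.1
  have h2 : Metric.ball (-f) δ ∩ {x | ⟪a H, x⟫ = 0} ⊆ H ∩ regionOf (pencil A H L) b := by
    rintro y ⟨hy, hyH⟩
    refine ⟨(ha.mem_iff hH y).2 hyH, (hap.mem_regionOf (hcompl hb)).2 fun K hK => ?_⟩
    by_cases hKH : K = H
    · subst hKH
      rw [show ⟪a K, y⟫ = 0 from hyH, mul_zero]
    · have h3 := hball y hy K hK.1 hKH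
      rw [inner_neg_right] at h3
      have h4 : ⟪a K, y⟫ < 0 := by
        by_contra hcon
        nlinarith [mul_nonneg (hf K hK.1 hKH).le (not_lt.1 hcon)]
      exact (mul_pos_of_neg_of_neg (hL K hK) h4).le
  rw [span_eq_of_ball_inter_subset hfH' h1 hδ h2, ← ha H hH]

/-- If some region strictly below the region of `j` is still separated from the base region by
the wall `H`, then moving along the shard in `H` yields a smaller region of `U(Σ)`. -/
theorem exists_upperRegion_lt (hfin : A.Finite) (ha : IsNormalFamily A a)
    (hb : b ∈ arrComplement A) (hj : ∀ K ∈ A, 0 < ⟪a K, j⟫) (hH : H ∈ A)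
    {f : EuclideanSpace ℝ (Fin n)} (hfH : ⟪a H, f⟫ = 0)
    (hf : ∀ K ∈ A, K ≠ H → 0 < ⟪a K, f⟫) (hHb : ⟪a H, b⟫ < 0)
    {r : EuclideanSpace ℝ (Fin n)} (hr : r ∈ arrComplement A)
    (hlt : regLT A (regionOf A b) (regionOf A r) (regionOf A j))
    (hHr : H ∈ sepSet A (regionOf A b) (regionOf A r)) :
    ∃ R ∈ upperRegions A (regionOf A b) H
        (connectedComponentIn (shardCut A (regionOf A b) H) f),
      regLT A (regionOf A b) R (regionOf A j) := by
  have hr0 := ha.mem_arrComplement.1 hr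
  have hb0 := ha.mem_arrComplement.1 hb
  have hrb : ∀ K ∈ A, ⟪a K, r⟫ < 0 → ⟪a K, b⟫ < 0 := by
    intro K hK hKr
    by_contra hcon
    have hKb : 0 < ⟪a K, b⟫ := lt_of_le_of_ne (not_lt.1 hcon) (hb0 K hK).symm
    exact hcon ((mem_sepSet_of_pos hfin ha hb hj).1
      (hlt.1 ((ha.mem_sepSet hfin hb hr).2 ⟨hK, mul_neg_of_neg_of_pos hKr hKb⟩))).2
  have hHr' : 0 < ⟪a H, r⟫ := by
    have := ((ha.mem_sepSet hfin hb hr).1 hHr).2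
    by_contra hcon
    nlinarith
  obtain ⟨K₀, hK₀, hK₀b, hK₀r⟩ : ∃ K ∈ A, ⟪a K, b⟫ < 0 ∧ ⟪a K, r⟫ < 0 := by
    obtain ⟨K, hKj, hKr⟩ := Set.not_subset.1 hlt.2
    obtain ⟨hK, hKb⟩ := (mem_sepSet_of_pos hfin ha hb hj).1 hKj
    refine ⟨K, hK, hKb, ?_⟩
    by_contra hcon
    have : 0 < ⟪a K, r⟫ := lt_of_le_of_ne (not_lt.1 hcon) (hr0 K hK).symm
    exact hKr ((ha.mem_sepSet hfin hb hr).2 ⟨hK, mul_neg_of_pos_of_neg this hKb⟩)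
  -- the ray from `r` in direction `b` meets `H` at `q`
  obtain ⟨u, hu, hqH⟩ : ∃ u : ℝ, 0 < u ∧ ⟪a H, r⟫ + u * ⟪a H, b⟫ = 0 :=
    ⟨⟪a H, r⟫ / -⟪a H, b⟫, div_pos hHr' (neg_pos.2 hHb), by
      rw [div_neg, neg_mul, div_mul_cancel₀ _ hHb.ne, add_neg_cancel]⟩
  set q := r + u • b with hq
  have hqe : ∀ K, ⟪a K, q⟫ = ⟪a K, r⟫ + u * ⟪a K, b⟫ := fun K => by
    simp [hq, inner_add_right, real_inner_smul_right]
  have hqb : ∀ K ∈ A, ⟪a K, q⟫ < 0 → ⟪a K, b⟫ < 0 := by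
    intro K hK hKq
    by_contra hcon
    have h1 : 0 < ⟪a K, r⟫ := lt_of_le_of_ne
      (not_lt.1 fun h => hcon (hrb K hK h)) (hr0 K hK).symm
    rw [hqe] at hKq
    nlinarith [mul_nonneg hu.le (not_lt.1 hcon)]
  have hqH' : ⟪a H, q⟫ = 0 := by rw [hqe, hqH]
  have hqK₀ : ⟪a K₀, q⟫ < 0 := by
    rw [hqe]; nlinarith
  -- the point `g` on the segment from `q` to `f`, close to `q`
  obtain ⟨ε, hε, hpert⟩ := exists_perturbation hfin a q f
  have hgcompl : ∀ K ∈ A, K ≠ H → ⟪a K, q + ε • f⟫ ≠ 0 := by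
    intro K hK hKH
    simp only [inner_add_right, real_inner_smul_right]
    rcases lt_or_ge ⟪a K, q⟫ 0 with h | h
    · exact ((hpert K hK).2 h).ne
    · have := mul_pos hε (hf K hK hKH)
      positivity
  set g := q + ε • f with hg
  have hge : ∀ K, ⟪a K, g⟫ = ⟪a K, q⟫ + ε * ⟪a K, f⟫ := fun K => by
    simp [hg, inner_add_right, real_inner_smul_right]
  have hgH : ⟪a H, g⟫ = 0 := by rw [hge, hqH', hfH]; simp
  have hgq : ∀ K ∈ A, ⟪a K, g⟫ < 0 → ⟪a K, q⟫ < 0 := by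
    intro K hK hKg
    by_cases hKH : K = H
    · subst hKH; exact absurd hgH hKg.ne
    · rw [hge] at hKg
      nlinarith [mul_pos hε (hf K hK hKH)]
  have hfcut : f ∈ shardCut A (regionOf A b) H := ha.mem_shardCut hH hfH fun K hK hKH h =>
    absurd h (hf K hK hKH).ne'
  have hseg : segment ℝ f g ⊆ shardCut A (regionOf A b) H := by
    rintro _ ⟨s, t, hs, ht, hst, rfl⟩
    have hye : ∀ K, ⟪a K, s • f + t • g⟫ = (s + t * ε) * ⟪a K, f⟫ + t * ⟪a K, q⟫ := fun K => by
      simp only [inner_add_right, real_inner_smul_right, hge]; ring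
    have hstε : 0 < s + t * ε := by
      rcases hs.eq_or_lt with rfl | hs
      · have : t = 1 := by linarith
        subst this; linarith
      · positivity
    refine ha.mem_shardCut hH (by rw [hye, hfH, hqH']; ring) fun L hL hLH hyL => ?_
    refine isBasicIn_pencil hfin ha hb hH hfH hf fun K hK => ?_
    by_cases hKH : K = H
    · rw [hKH]; exact hHb
    have hyK : s • f + t • g ∈ K := hK.2 ⟨(ha.mem_iff hH _).2 (by rw [hye, hfH, hqH']; ring),
      (ha.mem_iff hL _).2 hyL⟩
    rw [ha.mem_iff hK.1, hye] at hyK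
    refine hqb K hK.1 ?_
    by_contra hcon
    nlinarith [mul_pos hstε (hf K hK.1 hKH), mul_nonneg ht (not_lt.1 hcon)]
  have hcomp : connectedComponentIn (shardCut A (regionOf A b) H) f =
      connectedComponentIn (shardCut A (regionOf A b) H) g :=
    connectedComponentIn_eq ((convex_segment f g).isPreconnected.subset_connectedComponentIn
      (left_mem_segment ℝ f g) hseg (right_mem_segment ℝ f g))
  -- the region above `H` at `g`
  obtain ⟨η, hη, hpert'⟩ := exists_perturbation hfin a g j
  set ρ := g + η • j with hρ
  have hρe : ∀ K, ⟪a K, ρ⟫ = ⟪a K, g⟫ + η * ⟪a K, j⟫ := fun K => by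
    simp [hρ, inner_add_right, real_inner_smul_right]
  have hρH : 0 < ⟪a H, ρ⟫ := by
    rw [hρe, hgH]; have := mul_pos hη (hj H hH); linarith
  have hsign : ∀ K ∈ A, K ≠ H → 0 < ⟪a K, ρ⟫ * ⟪a K, g⟫ := by
    intro K hK hKH
    rw [hρe]
    rcases (hgcompl K hK hKH).lt_or_gt with h | h
    · exact mul_pos_of_neg_of_neg ((hpert' K hK).2 h) h
    · exact mul_pos ((hpert' K hK).1 h) h
  have hρcompl : ρ ∈ arrComplement A := ha.mem_arrComplement.2 fun K hK h => by
    by_cases hKH : K = H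
    · subst hKH; exact hρH.ne' h
    · simpa [h] using hsign K hK hKH
  have hρg : ∀ K ∈ A, ⟪a K, ρ⟫ < 0 → ⟪a K, g⟫ < 0 := by
    intro K hK h
    rw [hρe] at h
    nlinarith [mul_pos hη (hj K hK)]
  refine ⟨regionOf A ρ, ⟨isRegion_regionOf hρcompl, ?_, ?_⟩, ?_, ?_⟩
  · rw [hcomp]
    exact ha.span_regionOf_inter_shard hfin hH hgH hρcompl hsign
  · exact (ha.mem_sepSet hfin hb hρcompl).2 ⟨hH, mul_neg_of_pos_of_neg hρH hHb⟩
  · exact regLE_of_pos hfin ha hb hj hρcompl fun K hK h => hqb K hK (hgq K hK (hρg K hK h))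
  · refine not_regLE_of_pos hfin ha hb hj hρcompl hK₀ hK₀b ?_
    rw [hρe]
    refine (hpert' K₀ hK₀).2 ?_
    rw [hge]
    exact (hpert K₀ hK₀).2 hqK₀

/-- A region meeting a shard in codimension one contains a point of the shard that lies on no
hyperplane other than that of the shard. -/
theorem exists_mem_shard_generic (hfin : A.Finite) (ha : IsNormalFamily A a)
    (hj : ∀ K ∈ A, 0 < ⟪a K, j⟫) {B Sg : Set (EuclideanSpace ℝ (Fin n))}
    (hSg : IsShardOf A B H Sg)
    (hspan : Submodule.span ℝ (regionOf A j ∩ Sg) = Submodule.span ℝ H) :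
    ∃ f, ⟪a H, f⟫ = 0 ∧ (∀ K ∈ A, K ≠ H → 0 < ⟪a K, f⟫) ∧
      Sg = connectedComponentIn (shardCut A B H) f := by
  obtain ⟨hH, x, hx, rfl⟩ := hSg
  have hjc := mem_arrComplement_of_pos ha hj
  set Sg := connectedComponentIn (shardCut A B H) x with hSgdef
  have hJ : ∀ y, y ∈ regionOf A j ↔ ∀ K ∈ A, 0 ≤ ⟪a K, y⟫ := fun y => by
    rw [ha.mem_regionOf hjc]
    exact forall₂_congr fun K hK => mul_nonneg_iff_of_pos_left (hj K hK)
  have hSgH : ∀ y ∈ Sg, ⟪a H, y⟫ = 0 := fun y hy =>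
    (ha.mem_iff hH y).1 (connectedComponentIn_subset _ _ hy).1
  obtain ⟨y₀, hy₀J, hy₀S⟩ : (regionOf A j ∩ Sg).Nonempty := by
    by_contra hne
    rw [Set.not_nonempty_iff_eq_empty] at hne
    rw [hne, Submodule.span_empty] at hspan
    have hx0 : x = 0 := by
      have : x ∈ Submodule.span ℝ H := Submodule.subset_span hx.1
      rwa [← hspan, Submodule.mem_bot] at this
    have : x ∈ regionOf A j ∩ Sg := ⟨(hJ x).2 fun K _ => by simp [hx0], mem_connectedComponentIn hx⟩
    simp [hne] at this
  have hex : ∀ K ∈ A, K ≠ H → ∃ y ∈ regionOf A j ∩ Sg, 0 < ⟪a K, y⟫ := by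
    intro K hK hKH
    by_contra! hcon
    refine hKH (ha.eq_of_subset hH hK hjc fun z hz => ?_)
    have hle : Submodule.span ℝ (regionOf A j ∩ Sg) ≤ LinearMap.ker (innerₛₗ ℝ (a K)) := by
      refine Submodule.span_le.2 fun y hy => ?_
      exact le_antisymm (hcon y hy) ((hJ y).1 hy.1 K hK)
    have : z ∈ LinearMap.ker (innerₛₗ ℝ (a K)) := hle (hspan ▸ Submodule.subset_span hz)
    exact (ha.mem_iff hK z).2 this
  choose! p hp hpK using hex
  classical
  set T := hfin.toFinset.filter (· ≠ H) with hT
  have hTm : ∀ K, K ∈ T ↔ K ∈ A ∧ K ≠ H := by simp [hT]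
  set f := y₀ + ∑ K ∈ T, p K with hfdef
  have hfe : ∀ K, ⟪a K, f⟫ = ⟪a K, y₀⟫ + ∑ L ∈ T, ⟪a K, p L⟫ := fun K => by
    rw [hfdef, inner_add_right, inner_sum]
  have hfH : ⟪a H, f⟫ = 0 := by
    rw [hfe, hSgH y₀ hy₀S, Finset.sum_eq_zero, add_zero]
    intro L hL
    exact hSgH _ (hp L ((hTm L).1 hL).1 ((hTm L).1 hL).2).2
  have hfpos : ∀ K ∈ A, K ≠ H → 0 < ⟪a K, f⟫ := by
    intro K hK hKH
    rw [hfe]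
    refine add_pos_of_nonneg_of_pos ((hJ y₀).1 hy₀J K hK) (Finset.sum_pos' (fun L hL => ?_)
      ⟨K, (hTm K).2 ⟨hK, hKH⟩, hpK K hK hKH⟩)
    exact (hJ _).1 (hp L ((hTm L).1 hL).1 ((hTm L).1 hL).2).1 K hK
  refine ⟨f, hfH, hfpos, connectedComponentIn_eq ?_⟩
  have hseg : segment ℝ y₀ f ⊆ shardCut A B H := by
    rintro _ ⟨s, t, hs, ht, hst, rfl⟩
    rcases ht.eq_or_lt with rfl | ht
    · have : s = 1 := by linarith
      subst this
      simpa using connectedComponentIn_subset _ _ hy₀S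
    · refine ha.mem_shardCut hH ?_ fun K hK hKH h => ?_
      · simp [inner_add_right, real_inner_smul_right, hfH, hSgH y₀ hy₀S]
      · simp only [inner_add_right, real_inner_smul_right] at h
        nlinarith [mul_nonneg hs ((hJ y₀).1 hy₀J K hK), mul_pos ht (hfpos K hK hKH)]
  have := (convex_segment y₀ f).isPreconnected.subset_connectedComponentIn
    (left_mem_segment ℝ y₀ f) hseg (right_mem_segment ℝ y₀ f)
  rwa [← connectedComponentIn_eq hy₀S] at this

/-- Crossing the wall `H` at the point `f` removes exactly `H` from the separating set. -/
theorem exists_region_sepSet_diff (hfin : A.Finite) (ha : IsNormalFamily A a)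
    (hb : b ∈ arrComplement A) (hj : ∀ K ∈ A, 0 < ⟪a K, j⟫) (hH : H ∈ A)
    {f : EuclideanSpace ℝ (Fin n)} (hfH : ⟪a H, f⟫ = 0)
    (hf : ∀ K ∈ A, K ≠ H → 0 < ⟪a K, f⟫) (hHb : ⟪a H, b⟫ < 0) :
    ∃ s ∈ arrComplement A, sepSet A (regionOf A b) (regionOf A s) =
      sepSet A (regionOf A b) (regionOf A j) \ {H} := by
  obtain ⟨ε, hε, hpert⟩ := exists_perturbation hfin a f (-j)
  have hse : ∀ K, ⟪a K, f + ε • -j⟫ = ⟪a K, f⟫ + ε * ⟪a K, -j⟫ := fun K => by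
    simp only [inner_add_right, real_inner_smul_right]
  have hpos : ∀ K ∈ A, K ≠ H → 0 < ⟪a K, f + ε • -j⟫ := fun K hK hKH => by
    rw [hse]; exact (hpert K hK).1 (hf K hK hKH)
  have hneg : ⟪a H, f + ε • -j⟫ < 0 := by
    rw [hse, hfH, inner_neg_right]; nlinarith [hj H hH]
  have hs : f + ε • -j ∈ arrComplement A := ha.mem_arrComplement.2 fun K hK => by
    by_cases hKH : K = H
    · subst hKH; exact hneg.ne
    · exact (hpos K hK hKH).ne'
  refine ⟨_, hs, ?_⟩
  ext K
  rw [Set.mem_sdiff, ha.mem_sepSet hfin hb hs, mem_sepSet_of_pos hfin ha hb hj,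
    Set.mem_singleton_iff]
  by_cases hKH : K = H
  · subst hKH
    simp only [not_true_eq_false, and_false, iff_false, not_and, not_lt]
    exact fun _ => (mul_pos_of_neg_of_neg hneg hHb).le
  · simp only [hKH, not_false_eq_true, and_true]
    refine and_congr_right fun hK => ?_
    have := hpos K hK hKH
    exact ⟨fun h => by by_contra h'; nlinarith, fun h => mul_neg_of_pos_of_neg this h⟩

/-- If `H` separates no region strictly below the region of `j` from the base region, then the ray
from `j` towards the base region leaves the region of `j` through the relative interior of a
facet in `H`. -/
theorem exists_generic_wall_point (hfin : A.Finite) (ha : IsNormalFamily A a)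
    (hb : b ∈ arrComplement A) (hj : ∀ K ∈ A, 0 < ⟪a K, j⟫) (hH : H ∈ A) (hHb : ⟪a H, b⟫ < 0)
    (hmin : ∀ R, IsRegion A R → regLT A (regionOf A b) R (regionOf A j) →
      H ∉ sepSet A (regionOf A b) R) :
    ∃ f, ⟪a H, f⟫ = 0 ∧ ∀ K ∈ A, K ≠ H → 0 < ⟪a K, f⟫ := by
  have hb0 := ha.mem_arrComplement.1 hb
  have hcross : ∀ x, (∀ K ∈ A, 0 < ⟪a K, x⟫) → ∀ K ∈ A, ⟪a K, b⟫ < 0 →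
      ⟪a H, x⟫ * -⟪a K, b⟫ ≤ ⟪a K, x⟫ * -⟪a H, b⟫ := by
    intro x hx K hK hKb
    by_contra! hcon
    obtain ⟨u, hu1, hu2⟩ : ∃ u, ⟪a K, x⟫ / -⟪a K, b⟫ < u ∧ u < ⟪a H, x⟫ / -⟪a H, b⟫ :=
      exists_between ((div_lt_div_iff₀ (neg_pos.2 hKb) (neg_pos.2 hHb)).2 hcon)
    have hu : 0 < u := (div_pos (hx K hK) (neg_pos.2 hKb)).trans hu1
    rw [div_lt_iff₀ (neg_pos.2 hKb)] at hu1
    rw [lt_div_iff₀ (neg_pos.2 hHb)] at hu2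
    set z := x + u • b with hz
    have hze : ∀ L, ⟪a L, z⟫ = ⟪a L, x⟫ + u * ⟪a L, b⟫ := fun L => by
      simp [hz, inner_add_right, real_inner_smul_right]
    obtain ⟨ε, hε, hpert⟩ := exists_perturbation hfin a z x
    have hwe : ∀ L, ⟪a L, z + ε • x⟫ = ⟪a L, z⟫ + ε * ⟪a L, x⟫ := fun L => by
      simp [inner_add_right, real_inner_smul_right]
    have hw : z + ε • x ∈ arrComplement A := ha.mem_arrComplement.2 fun L hL => by
      rw [hwe]
      rcases lt_or_ge ⟪a L, z⟫ 0 with h | h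
      · exact ((hpert L hL).2 h).ne
      · have := mul_pos hε (hx L hL)
        positivity
    have hwH : 0 < ⟪a H, z + ε • x⟫ := by
      rw [hwe]; exact (hpert H hH).1 (by rw [hze]; linarith)
    have hwK : ⟪a K, z + ε • x⟫ < 0 := by
      rw [hwe]; exact (hpert K hK).2 (by rw [hze]; linarith)
    refine hmin _ (isRegion_regionOf hw) ⟨regLE_of_pos hfin ha hb hj hw fun L hL h => ?_,
      not_regLE_of_pos hfin ha hb hj hw hK hKb hwK⟩
      ((ha.mem_sepSet hfin hb hw).2 ⟨hH, mul_neg_of_pos_of_neg hwH hHb⟩)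
    rw [hwe, hze] at h
    by_contra hcon'
    nlinarith [hx L hL, mul_pos hε (hx L hL), mul_nonneg hu.le (not_lt.1 hcon')]
  obtain ⟨u, hu, huH⟩ : ∃ u : ℝ, 0 < u ∧ ⟪a H, j⟫ + u * ⟪a H, b⟫ = 0 :=
    ⟨⟪a H, j⟫ / -⟪a H, b⟫, div_pos (hj H hH) (neg_pos.2 hHb), by
      rw [div_neg, neg_mul, div_mul_cancel₀ _ hHb.ne, add_neg_cancel]⟩
  refine ⟨j + u • b, by simpa [inner_add_right, real_inner_smul_right] using huH,
    fun K hK hKH => ?_⟩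
  simp only [inner_add_right, real_inner_smul_right]
  rcases (hb0 K hK).lt_or_gt with hKb | hKb
  swap
  · have := hj K hK
    positivity
  have hle := hcross j hj K hK hKb
  rcases hle.lt_or_eq with hlt | heq
  · have : 0 < (⟪a K, j⟫ + u * ⟪a K, b⟫) * -⟪a H, b⟫ := by
      have : (⟪a K, j⟫ + u * ⟪a K, b⟫) * -⟪a H, b⟫ =
          ⟪a K, j⟫ * -⟪a H, b⟫ - ⟪a H, j⟫ * -⟪a K, b⟫ := by
        linear_combination (-⟪a K, b⟫) * huH
      linarith
    exact pos_of_mul_pos_left this (neg_pos.2 hHb).le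
  · refine absurd (ha.eq_of_subset hH hK (mem_arrComplement_of_pos ha hj) fun y hy => ?_) hKH
    rw [ha.mem_iff hH] at hy
    have hnn : ∀ y, ⟪a H, y⟫ = 0 → 0 ≤ ⟪a K, y⟫ := by
      intro y hy
      obtain ⟨ε, hε, hpert⟩ := exists_perturbation hfin a j y
      have := hcross (j + ε • y) (fun L hL => by
        simpa [inner_add_right, real_inner_smul_right] using (hpert L hL).1 (hj L hL)) K hK hKb
      simp only [inner_add_right, real_inner_smul_right, hy, mul_zero, add_zero] at this
      have h1 : 0 ≤ (ε * -⟪a H, b⟫) * ⟪a K, y⟫ := by nlinarith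
      exact nonneg_of_mul_nonneg_right h1 (mul_pos hε (neg_pos.2 hHb))
    have h1 := hnn y hy
    have h2 := hnn (-y) (by simp [hy])
    rw [inner_neg_right] at h2
    exact (ha.mem_iff hK y).2 (by linarith)

end Oriented

/-- **Proposition (Reading, Proposition 4).** A region `J` is join-irreducible in 𝒫(𝒜,B) if
and only if `J` is a minimal element of U(Σ) for some shard Σ of `(A,B)`; in that case `J`
covers exactly one region `J_*`, and `S(J_*) = S(J) − {H_Σ}`. -/
theorem joinIrreducible_iff_minimal_upperRegions {n : ℕ}
    (A : Set (Set (EuclideanSpace ℝ (Fin n)))) (B : Set (EuclideanSpace ℝ (Fin n)))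
    (hA : IsCentralArrangement A) (hB : IsRegion A B)
    (J : Set (EuclideanSpace ℝ (Fin n))) (hJ : IsRegion A J) :
    (JoinIrredReg A B J ↔ ∃ H Sg, IsShardOf A B H Sg ∧ MinimalInU A B H Sg J) ∧
    (∀ H Sg, IsShardOf A B H Sg → MinimalInU A B H Sg J →
      ∃ Jst, CoversReg A B J Jst ∧ (∀ J', CoversReg A B J J' → J' = Jst) ∧
        sepSet A B Jst = sepSet A B J \ {H}) := by
  obtain ⟨b, hb, rfl⟩ := hB
  obtain ⟨j, hjc, rfl⟩ := hJ
  change (JoinIrredReg A (regionOf A b) (regionOf A j) ↔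
      ∃ H Sg, IsShardOf A (regionOf A b) H Sg ∧
        MinimalInU A (regionOf A b) H Sg (regionOf A j)) ∧
    (∀ H Sg, IsShardOf A (regionOf A b) H Sg → MinimalInU A (regionOf A b) H Sg (regionOf A j) →
      ∃ Jst, CoversReg A (regionOf A b) (regionOf A j) Jst ∧
        (∀ J', CoversReg A (regionOf A b) (regionOf A j) J' → J' = Jst) ∧
        sepSet A (regionOf A b) Jst = sepSet A (regionOf A b) (regionOf A j) \ {H})
  obtain ⟨a, ha, hj⟩ := hA.exists_normalFamily hjc
  have hfin := hA.1
  have hanti : ∀ R S, IsRegion A R → IsRegion A S →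
      sepSet A (regionOf A b) R = sepSet A (regionOf A b) S → R = S := by
    rintro _ _ ⟨r, hr, rfl⟩ ⟨s, hs, rfl⟩ h
    exact ha.regionOf_eq_of_sepSet_eq hfin hb hr hs h
  have hmax : ∀ H Sg, IsShardOf A (regionOf A b) H Sg →
      MinimalInU A (regionOf A b) H Sg (regionOf A j) →
      ∃ Jst, IsRegion A Jst ∧ regLT A (regionOf A b) Jst (regionOf A j) ∧
        sepSet A (regionOf A b) Jst = sepSet A (regionOf A b) (regionOf A j) \ {H} ∧
        ∀ R, IsRegion A R → regLT A (regionOf A b) R (regionOf A j) →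
          regLE A (regionOf A b) R Jst := by
    rintro H Sg hSg ⟨⟨-, hspan, hHJ⟩, hmin⟩
    obtain ⟨f, hfH, hf, rfl⟩ := exists_mem_shard_generic hfin ha hj hSg hspan
    have hH := hSg.1
    have hHb := ((mem_sepSet_of_pos hfin ha hb hj).1 hHJ).2
    obtain ⟨s, hs, hsep⟩ := exists_region_sepSet_diff hfin ha hb hj hH hfH hf hHb
    refine ⟨_, isRegion_regionOf hs, ⟨?_, fun hle => ?_⟩, hsep, ?_⟩
    · exact hsep.trans_subset Set.sdiff_subset
    · have h := hle hHJ
      rw [hsep] at h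
      exact h.2 rfl
    · rintro _ ⟨r, hr, rfl⟩ hlt K hK
      rw [hsep]
      refine ⟨hlt.1 hK, ?_⟩
      rintro rfl
      obtain ⟨R, hR, hRlt⟩ := exists_upperRegion_lt hfin ha hb hj hH hfH hf hHb hr hlt hK
      exact hRlt.2 (hmin R hR hRlt.1)
  refine ⟨⟨fun hirr => ?_, ?_⟩, fun H Sg hSg hmin => ?_⟩
  · have hnlub : ¬ regIsLUB A (regionOf A b)
        {R | IsRegion A R ∧ regLT A (regionOf A b) R (regionOf A j)} (regionOf A j) := fun h =>
      hirr.2 ⟨_, fun R hR => hR.1, fun hJ => hJ.2.2 hJ.2.1, h⟩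
    obtain ⟨R', -, hub, hnle⟩ : ∃ R', IsRegion A R' ∧ regIsUB A (regionOf A b)
        {R | IsRegion A R ∧ regLT A (regionOf A b) R (regionOf A j)} R' ∧
        ¬ regLE A (regionOf A b) (regionOf A j) R' := by
      by_contra! hcon
      exact hnlub ⟨fun R hR => hR.2.1, hcon⟩
    obtain ⟨H, hHJ, hHR'⟩ := Set.not_subset.1 hnle
    obtain ⟨hH, hHb⟩ := (mem_sepSet_of_pos hfin ha hb hj).1 hHJ
    have hbelow : ∀ R, IsRegion A R → regLT A (regionOf A b) R (regionOf A j) →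
        H ∉ sepSet A (regionOf A b) R := fun R hR hlt hHR => hHR' (hub R ⟨hR, hlt⟩ hHR)
    obtain ⟨f, hfH, hf⟩ := exists_generic_wall_point hfin ha hb hj hH hHb hbelow
    refine ⟨H, _, ⟨hH, f, ha.mem_shardCut hH hfH fun K hK hKH h =>
      absurd h (hf K hK hKH).ne', rfl⟩, ⟨hirr.1, ?_, hHJ⟩, fun R hR hle => ?_⟩
    · exact ha.span_regionOf_inter_shard hfin hH hfH hjc fun K hK hKH =>
        mul_pos (hj K hK) (hf K hK hKH)
    · by_contra hnle'
      exact hbelow R hR.1 ⟨hle, hnle'⟩ hR.2.2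
  · rintro ⟨H, Sg, hSg, hmin⟩
    obtain ⟨Jst, hreg, hlt, -, hmaxJ⟩ := hmax H Sg hSg hmin
    refine ⟨hmin.1.1, ?_⟩
    rintro ⟨X, hX, hJX, hub, hlub⟩
    refine hlt.2 (hlub Jst hreg fun R hR => hmaxJ R (hX R hR) ⟨hub R hR, fun hle => hJX ?_⟩)
    rwa [hanti _ _ hmin.1.1 (hX R hR) (hle.antisymm (hub R hR))]
  · obtain ⟨Jst, hreg, hlt, hsep, hmaxJ⟩ := hmax H Sg hSg hmin
    refine ⟨Jst, ⟨hreg, hlt, fun R hR h1 h2 => h1.2 (hmaxJ R hR h2)⟩, fun J' hJ' => ?_, hsep⟩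
    have hle := hmaxJ J' hJ'.1 hJ'.2.1
    refine hanti _ _ hJ'.1 hreg (hle.antisymm ?_)
    by_contra hnle
    exact hJ'.2.2 Jst hreg ⟨hle, hnle⟩ hlt
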